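/- Soundness of double delay simulation: let A1 = (S1, step1, F1) and A2 = (S2, step2, F2) be Büchi automata over the same event type E, and define delay(X) := lfp (fun Y => Match(Y) ⊔ X) and fsim_2delay := delay(fsimL_delay). If fsim_2delay s1 s2 holds, then L_{A1}(s1) ⊆ L_{A2}(s2). -/

import Mathlib

namespace AFS

/-- Greatest fixed point (Knaster–Tarski): for a monotone `f`, this is the
greatest fixed point of `f`. -/
def gfp {α : Type*} [CompleteLattice α] (f : α → α) : α := sSup {a | a ≤ f a}

/-- Least fixed point (Knaster–Tarski): for a monotone `f`, this is the
least fixed point of `f`. -/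
def lfp {α : Type*} [CompleteLattice α] (f : α → α) : α := sInf {a | f a ≤ a}

variable {E S S1 S2 : Type*}

/-- `ρ` is a run of the transition relation `step` from state `s` over the infinite word `τ`. -/
def IsRun (step : S → E → S → Prop) (s : S) (τ : ℕ → E) (ρ : ℕ → S) : Prop :=
  ρ 0 = s ∧ ∀ n, step (ρ n) (τ n) (ρ (n + 1))

/-- Büchi language of a state: words admitting a run visiting `F` infinitely often. -/
def Lang (step : S → E → S → Prop) (F : Set S) (s : S) : Set (ℕ → E) :=
  {τ | ∃ ρ, IsRun step s τ ρ ∧ {n | ρ n ∈ F}.Infinite}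

/-- Traces of a state: words admitting a run (no acceptance requirement). -/
def Traces (step : S → E → S → Prop) (s : S) : Set (ℕ → E) :=
  {τ | ∃ ρ, IsRun step s τ ρ}

/-- One-step matching operator on relations. -/
def Match (step1 : S1 → E → S1 → Prop) (step2 : S2 → E → S2 → Prop)
    (X : S1 → S2 → Prop) : S1 → S2 → Prop :=
  fun s1 s2 => ∀ e s1', step1 s1 e s1' → ∃ s2', step2 s2 e s2' ∧ X s1' s2'

/-- Inductive part of delay simulation: reach a right-accepting state, then pass to `X`. -/
def fsimRdelay (step1 : S1 → E → S1 → Prop) (step2 : S2 → E → S2 → Prop)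
    (F2 : Set S2) (X : S1 → S2 → Prop) : S1 → S2 → Prop :=
  lfp (fun Y =>
    (fun s1 s2 => s2 ∈ F2 ∧ Match step1 step2 X s1 s2) ⊔ Match step1 step2 Y)

/-- Functor underlying delay simulation. -/
def fsimLdelayF (step1 : S1 → E → S1 → Prop) (F1 : Set S1)
    (step2 : S2 → E → S2 → Prop) (F2 : Set S2)
    (X : S1 → S2 → Prop) : S1 → S2 → Prop :=
  fsimRdelay step1 step2 F2 X ⊔ (fun s1 s2 => s1 ∉ F1 ∧ Match step1 step2 X s1 s2)

/-- Delay simulation. -/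
def fsimLdelay (step1 : S1 → E → S1 → Prop) (F1 : Set S1)
    (step2 : S2 → E → S2 → Prop) (F2 : Set S2) : S1 → S2 → Prop :=
  gfp (fsimLdelayF step1 F1 step2 F2)

/-- The `delay` operator: wait for finitely many steps, then pass to `X`. -/
def delay (step1 : S1 → E → S1 → Prop) (step2 : S2 → E → S2 → Prop)
    (X : S1 → S2 → Prop) : S1 → S2 → Prop :=
  lfp (fun Y => Match step1 step2 Y ⊔ X)

/-- Double delay simulation. -/
def fsim2delay (step1 : S1 → E → S1 → Prop) (F1 : Set S1)
    (step2 : S2 → E → S2 → Prop) (F2 : Set S2) : S1 → S2 → Prop :=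
  delay step1 step2 (fsimLdelay step1 F1 step2 F2)

/-- `AcceptsIn step F τ P k n s`: reading `τ` from position `n`, the state `s` can reach an
accepting state in `k` steps and then move on to a state satisfying `P`. -/
inductive AcceptsIn (step : S → E → S → Prop) (F : Set S) (τ : ℕ → E) (P : ℕ → S → Prop) :
    ℕ → ℕ → S → Prop
  | now {n s s'} : s ∈ F → step s (τ n) s' → P (n + 1) s' → AcceptsIn step F τ P 0 n s
  | later {k n s s'} : step s (τ n) s' → AcceptsIn step F τ P k (n + 1) s' →
      AcceptsIn step F τ P (k + 1) n s

/-- A ranked invariant whose rank can increase only at accepting states yields acceptance. -/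
theorem mem_Lang_of_rank {step : S → E → S → Prop} {F : Set S} {τ : ℕ → E}
    (R : ℕ → ℕ → S → Prop)
    (hR : ∀ k n s, R k n s →
      ∃ k' s', step s (τ n) s' ∧ R k' (n + 1) s' ∧ (s ∈ F ∨ k' < k))
    {k : ℕ} {s : S} (h : R k 0 s) : τ ∈ Lang step F s := by
  choose! rank next hstep hinv hdec using hR
  let conf : ℕ → ℕ × S :=
    fun n => Nat.rec (k, s) (fun n c => (rank c.1 n c.2, next c.1 n c.2)) n
  have inv : ∀ n, R (conf n).1 n (conf n).2 := by
    intro n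
    induction n with
    | zero => exact h
    | succ n ih => exact hinv _ _ _ ih
  refine ⟨fun n => (conf n).2, ⟨rfl, fun n => hstep _ _ _ (inv n)⟩, ?_⟩
  have reach : ∀ r n, (conf n).1 = r → ∃ m ≥ n, (conf m).2 ∈ F := by
    intro r
    induction r using Nat.strong_induction_on with
    | _ r ih =>
      intro n hn
      rcases hdec _ _ _ (inv n) with hF | hlt
      · exact ⟨n, le_rfl, hF⟩
      · obtain ⟨m, hm, hF⟩ := ih (conf (n + 1)).1 (hn ▸ hlt) (n + 1) rfl
        exact ⟨m, by omega, hF⟩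
  refine Set.infinite_of_forall_exists_gt fun n => ?_
  obtain ⟨m, hm, hF⟩ := reach _ (n + 1) rfl
  exact ⟨m, hF, hm⟩

theorem mem_Lang_of_acceptsIn {step : S → E → S → Prop} {F : Set S} {τ : ℕ → E}
    {P : ℕ → S → Prop} (hP : ∀ n s, P n s → ∃ k, AcceptsIn step F τ P k n s)
    {k : ℕ} {s : S} (h : AcceptsIn step F τ P k 0 s) : τ ∈ Lang step F s := by
  refine mem_Lang_of_rank (AcceptsIn step F τ P) (fun k n s h => ?_) h
  cases h with
  | now hF hs hn =>
    obtain ⟨k', hk'⟩ := hP _ _ hn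
    exact ⟨k', _, hs, hk', Or.inl hF⟩
  | later hs hn => exact ⟨_, _, hs, hn, Or.inr (Nat.lt_succ_self _)⟩

theorem Match_mono (step1 : S1 → E → S1 → Prop) (step2 : S2 → E → S2 → Prop) :
    Monotone (Match step1 step2) := by
  intro X Y hXY s1 s2 h e s1' hs
  obtain ⟨s2', hs2, hX⟩ := h e s1' hs
  exact ⟨s2', hs2, hXY _ _ hX⟩

theorem fsimLdelayF_mono (step1 : S1 → E → S1 → Prop) (F1 : Set S1)
    (step2 : S2 → E → S2 → Prop) (F2 : Set S2) :
    Monotone (fsimLdelayF step1 F1 step2 F2) := by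
  intro X Y hXY
  refine sup_le_sup (sInf_le_sInf fun Z hZ => (sup_le_sup_right ?_ _).trans (Set.mem_ofPred.mp hZ)) ?_
  · exact fun s1 s2 h => ⟨h.1, Match_mono step1 step2 hXY _ _ h.2⟩
  · exact fun s1 s2 h => ⟨h.1, Match_mono step1 step2 hXY _ _ h.2⟩

theorem fsimLdelay_le (step1 : S1 → E → S1 → Prop) (F1 : Set S1)
    (step2 : S2 → E → S2 → Prop) (F2 : Set S2) :
    fsimLdelay step1 F1 step2 F2 ≤
      fsimLdelayF step1 F1 step2 F2 (fsimLdelay step1 F1 step2 F2) :=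
  sSup_le fun _ hX => le_trans hX (fsimLdelayF_mono step1 F1 step2 F2 (le_sSup hX))

section Run

variable {step1 : S1 → E → S1 → Prop} {F1 : Set S1} {step2 : S2 → E → S2 → Prop} {F2 : Set S2}
  {τ : ℕ → E} {ρ : ℕ → S1} {X : S1 → S2 → Prop}

theorem exists_acceptsIn_of_Match (hρ : ∀ n, step1 (ρ n) (τ n) (ρ (n + 1)))
    {P : ℕ → S2 → Prop} {Y : S1 → S2 → Prop} {n : ℕ} {s : S2}
    (hY : ∀ s', Y (ρ (n + 1)) s' → ∃ k, AcceptsIn step2 F2 τ P k (n + 1) s')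
    (h : Match step1 step2 Y (ρ n) s) : ∃ k, AcceptsIn step2 F2 τ P k n s := by
  obtain ⟨s', hs, hs'⟩ := h _ _ (hρ n)
  obtain ⟨k, hk⟩ := hY s' hs'
  exact ⟨k + 1, .later hs hk⟩

theorem exists_acceptsIn_of_fsimRdelay (hρ : ∀ n, step1 (ρ n) (τ n) (ρ (n + 1)))
    {n : ℕ} {s : S2} (h : fsimRdelay step1 step2 F2 X (ρ n) s) :
    ∃ k, AcceptsIn step2 F2 τ (fun m => X (ρ m)) k n s := by
  let Y : S1 → S2 → Prop := fun s1 s2 =>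
    ∀ n, ρ n = s1 → ∃ k, AcceptsIn step2 F2 τ (fun m => X (ρ m)) k n s2
  have hY : fsimRdelay step1 step2 F2 X ≤ Y := by
    refine sInf_le ?_
    rintro _ s2 (⟨hF, hX⟩ | hM) n rfl
    · obtain ⟨s', hs, hs'⟩ := hX _ _ (hρ n)
      exact ⟨0, .now hF hs hs'⟩
    · exact exists_acceptsIn_of_Match hρ (fun s' h => h _ rfl) hM
  exact hY _ _ h n rfl

theorem exists_acceptsIn_of_fsimLdelayF (hρ : ∀ n, step1 (ρ n) (τ n) (ρ (n + 1)))
    (hF1 : {n | ρ n ∈ F1}.Infinite) (hX : X ≤ fsimLdelayF step1 F1 step2 F2 X)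
    {n : ℕ} {s : S2} (h : X (ρ n) s) :
    ∃ k, AcceptsIn step2 F2 τ (fun m => X (ρ m)) k n s := by
  obtain ⟨m, hm, hnm⟩ := hF1.exists_gt n
  replace hnm := hnm.le
  induction hnm using Nat.decreasingInduction generalizing s with
  | self =>
    rcases hX _ _ h with hR | ⟨hF, -⟩
    · exact exists_acceptsIn_of_fsimRdelay hρ hR
    · exact absurd hm hF
  | of_succ n hn ih =>
    rcases hX _ _ h with hR | ⟨-, hM⟩
    · exact exists_acceptsIn_of_fsimRdelay hρ hR
    · exact exists_acceptsIn_of_Match hρ (fun s' h => ih h) hM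

theorem exists_acceptsIn_of_delay (hρ : ∀ n, step1 (ρ n) (τ n) (ρ (n + 1)))
    {P : ℕ → S2 → Prop} (hX : ∀ n s, X (ρ n) s → ∃ k, AcceptsIn step2 F2 τ P k n s)
    {n : ℕ} {s : S2} (h : delay step1 step2 X (ρ n) s) :
    ∃ k, AcceptsIn step2 F2 τ P k n s := by
  let Y : S1 → S2 → Prop := fun s1 s2 =>
    ∀ n, ρ n = s1 → ∃ k, AcceptsIn step2 F2 τ P k n s2
  have hY : delay step1 step2 X ≤ Y := by
    refine sInf_le ?_
    rintro _ s2 (hM | h) n rfl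
    · exact exists_acceptsIn_of_Match hρ (fun s' h => h _ rfl) hM
    · exact hX _ _ h
  exact hY _ _ h n rfl

end Run

/-- Soundness of double delay simulation for language inclusion. -/
theorem stmt13 (step1 : S1 → E → S1 → Prop) (F1 : Set S1)
    (step2 : S2 → E → S2 → Prop) (F2 : Set S2)
    (s1 : S1) (s2 : S2) (h : fsim2delay step1 F1 step2 F2 s1 s2) :
    Lang step1 F1 s1 ⊆ Lang step2 F2 s2 := by
  rintro τ ⟨ρ, ⟨rfl, hρ⟩, hF1⟩
  have hL : ∀ n s, fsimLdelay step1 F1 step2 F2 (ρ n) s →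
      ∃ k, AcceptsIn step2 F2 τ (fun m => fsimLdelay step1 F1 step2 F2 (ρ m)) k n s :=
    fun _ _ => exists_acceptsIn_of_fsimLdelayF hρ hF1 (fsimLdelay_le step1 F1 step2 F2)
  obtain ⟨k, hk⟩ := exists_acceptsIn_of_delay hρ hL h
  exact mem_Lang_of_acceptsIn hL hk

end AFS
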